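/- arXiv:1112.3397 — 2 statements merged into one kernel-verified Lean document; each statement's English description precedes it below -/
import Mathlib

section
/- (Brink–Howlett) Let (W,S) be a finitely generated Coxeter system with Cayley graph Λ(W,S). There is a constant F, depending only on (W,S), such that any collection of pairwise crossing walls of Λ has cardinality at most F. -/
/-!
Common definitions: Cayley graph of a Coxeter system, walls, sides,
bracket numbers, edge paths, quasi-geodesics, tracking.
-/

namespace CoxTrack

variable {B : Type*} {W : Type*} [Group W] {M : CoxeterMatrix B}

/-- The word metric on the Cayley graph `Λ(W,S)`: `d u v = ℓ(u⁻¹ v)`. -/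
noncomputable def d (cs : CoxeterSystem M W) (u v : W) : ℕ := cs.length (u⁻¹ * v)

/-- `u` and `v` are adjacent vertices (endpoints of a common edge) of `Λ(W,S)`. -/
def Adj (cs : CoxeterSystem M W) (u v : W) : Prop := ∃ i : B, v = u * cs.simple i

/-- The edge with endpoints `u` and `v` belongs to the wall of the reflection `t`
(i.e. `t` fixes this edge setwise, interchanging its endpoints). -/
def EdgeInWall (cs : CoxeterSystem M W) (t u v : W) : Prop :=
  Adj cs u v ∧ t * u = v

/-- `v` is a vertex of `Q̄`, the union of the edges of the wall of the reflection `t`. -/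
def InWallBar (cs : CoxeterSystem M W) (t v : W) : Prop :=
  ∃ i : B, t * v = v * cs.simple i

/-- Vertices `u` and `v` lie on the same side of the wall of the reflection `t`. -/
def SameSide (cs : CoxeterSystem M W) (t u v : W) : Prop :=
  (cs.length (t * u) < cs.length u ↔ cs.length (t * v) < cs.length v)

/-- The wall of the reflection `t` separates the vertices `u` and `v`. -/
def SeparatesPts (cs : CoxeterSystem M W) (t u v : W) : Prop := ¬ SameSide cs t u v

/-- The walls of the reflections `t` and `t'` are parallel: they are distinct and
all edges of each one lie on one side of the other. -/
def Parallel (cs : CoxeterSystem M W) (t t' : W) : Prop :=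
  t ≠ t' ∧ (∀ u v, InWallBar cs t' u → InWallBar cs t' v → SameSide cs t u v)
         ∧ (∀ u v, InWallBar cs t u → InWallBar cs t v → SameSide cs t' u v)

/-- The walls of the reflections `t` and `t'` cross (they are distinct and not parallel). -/
def Crosses (cs : CoxeterSystem M W) (t t' : W) : Prop := t ≠ t' ∧ ¬ Parallel cs t t'

/-- The wall of the reflection `r` separates `Q̄` (for the wall of the reflection `t`)
from the vertex `p`. -/
def SepWallFromPt (cs : CoxeterSystem M W) (r t p : W) : Prop :=
  ∀ v, InWallBar cs t v → SeparatesPts cs r v p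

/-- The distance from the vertex `p` to `Q̄` (the wall of the reflection `t`),
measured to the nearest vertex of `Q̄`. -/
noncomputable def wallDist (cs : CoxeterSystem M W) (t p : W) : ℕ :=
  sInf {n : ℕ | ∃ v, InWallBar cs t v ∧ d cs p v = n}

/-- `v 0, v 1, …, v n` are the consecutive vertices of an edge path of length `n` in `Λ(W,S)`. -/
def IsPath (cs : CoxeterSystem M W) (v : ℕ → W) (n : ℕ) : Prop :=
  ∀ k, k < n → Adj cs (v k) (v (k+1))

/-- `v 0, …, v n` are the consecutive vertices of a geodesic edge path of length `n`. -/
def IsGeodesic (cs : CoxeterSystem M W) (v : ℕ → W) (n : ℕ) : Prop :=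
  IsPath cs v n ∧ d cs (v 0) (v n) = n

/-- `v 0, v 1, …` are the consecutive vertices of an edge path ray. -/
def IsRay (cs : CoxeterSystem M W) (v : ℕ → W) : Prop := ∀ k, Adj cs (v k) (v (k+1))

/-- A geodesic edge path ray. -/
def IsGeodesicRay (cs : CoxeterSystem M W) (v : ℕ → W) : Prop :=
  IsRay cs v ∧ ∀ j k, j ≤ k → d cs (v j) (v k) = k - j

/-- `…, v (-1), v 0, v 1, …` are the consecutive vertices of an edge path line. -/
def IsLine (cs : CoxeterSystem M W) (v : ℤ → W) : Prop := ∀ k : ℤ, Adj cs (v k) (v (k+1))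

/-- A geodesic edge path line. -/
def IsGeodesicLine (cs : CoxeterSystem M W) (v : ℤ → W) : Prop :=
  IsLine cs v ∧ ∀ j k : ℤ, j ≤ k → (d cs (v j) (v k) : ℤ) = k - j

/-- The set of (reflections of) walls bracketing the vertex `v k` of the edge path
`v 0, …, v n`: walls containing an edge of the path before `v k` and an edge after `v k`. -/
def Brackets (cs : CoxeterSystem M W) (v : ℕ → W) (n k : ℕ) : Set W :=
  {t | ∃ j m, j < k ∧ k ≤ m ∧ m < n ∧
      EdgeInWall cs t (v j) (v (j+1)) ∧ EdgeInWall cs t (v m) (v (m+1))}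

/-- The set of walls bracketing the vertex `v k` of the edge path ray `v`. -/
def BracketsRay (cs : CoxeterSystem M W) (v : ℕ → W) (k : ℕ) : Set W :=
  {t | ∃ j m, j < k ∧ k ≤ m ∧
      EdgeInWall cs t (v j) (v (j+1)) ∧ EdgeInWall cs t (v m) (v (m+1))}

/-- The set of walls bracketing the vertex `v k` of the edge path line `v`. -/
def BracketsLine (cs : CoxeterSystem M W) (v : ℤ → W) (k : ℤ) : Set W :=
  {t | ∃ j m : ℤ, j < k ∧ k ≤ m ∧
      EdgeInWall cs t (v j) (v (j+1)) ∧ EdgeInWall cs t (v m) (v (m+1))}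

/-- The edge path `v 0, …, v n` is a `(lam, eps)`-quasi-geodesic. -/
def IsQG (cs : CoxeterSystem M W) (lam eps : ℝ) (v : ℕ → W) (n : ℕ) : Prop :=
  IsPath cs v n ∧ ∀ j k, j ≤ n → k ≤ n →
    |(j : ℝ) - (k : ℝ)| ≤ lam * (d cs (v j) (v k) : ℝ) + eps

/-- The edge path ray `v` is a `(lam, eps)`-quasi-geodesic. -/
def IsQGRay (cs : CoxeterSystem M W) (lam eps : ℝ) (v : ℕ → W) : Prop :=
  IsRay cs v ∧ ∀ j k : ℕ, |(j : ℝ) - (k : ℝ)| ≤ lam * (d cs (v j) (v k) : ℝ) + eps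

/-- The edge path line `v` is a `(lam, eps)`-quasi-geodesic. -/
def IsQGLine (cs : CoxeterSystem M W) (lam eps : ℝ) (v : ℤ → W) : Prop :=
  IsLine cs v ∧ ∀ j k : ℤ, |(j : ℝ) - (k : ℝ)| ≤ lam * (d cs (v j) (v k) : ℝ) + eps

/-- `P` is a Parallel Wall function for `(W,S)`: for each positive integer `n`, every wall `Q`
and every vertex `p` at distance at least `P n` from `Q̄`, there are `n` distinct pairwise
parallel walls separating `Q̄` from `p`. -/
def IsParallelWallFn (cs : CoxeterSystem M W) (P : ℕ → ℕ) : Prop :=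
  ∀ n : ℕ, 0 < n → ∀ t p : W, cs.IsReflection t → P n ≤ wallDist cs t p →
    ∃ T : Finset W, T.card = n ∧ (∀ r ∈ T, cs.IsReflection r) ∧
      (∀ r ∈ T, ∀ r' ∈ T, r ≠ r' → Parallel cs r r') ∧
      (∀ r ∈ T, SepWallFromPt cs r t p)

/-- `w 0, …, w m` (with distinguished approximation vertices `w (c 0), …, w (c n)`)
is an `L`-approximation of the edge path `v 0, …, v n`: it is an edge path with the
same endpoints, the segment from `w (c i)` to `w (c (i+1))` is geodesic, and the
approximation vertex `w (c i)` is within `L` of `v i`. -/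
def IsApprox (cs : CoxeterSystem M W) (L : ℕ) (v : ℕ → W) (n : ℕ)
    (w : ℕ → W) (m : ℕ) (c : ℕ → ℕ) : Prop :=
  IsPath cs w m ∧ c 0 = 0 ∧ c n = m ∧ (∀ i, i < n → c i ≤ c (i+1)) ∧
  w 0 = v 0 ∧ w m = v n ∧
  (∀ i, i ≤ n → d cs (w (c i)) (v i) ≤ L) ∧
  (∀ i, i < n → d cs (w (c i)) (w (c (i+1))) = c (i+1) - c i)

@[simp]
theorem end_mul_apply {α : Type*} (f g : Function.End α) (a : α) : (f * g) a = f (g a) := rfl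

@[simp]
theorem end_one_apply {α : Type*} (a : α) : (1 : Function.End α) a = a := rfl

open Classical in
/-- The action of a simple reflection on `W × ZMod 2` that conjugates the first coordinate and
shifts the second one at the simple reflection itself. -/
noncomputable def signedConj (cs : CoxeterSystem M W) (i : B) : Function.End (W × ZMod 2) :=
  fun p ↦ (cs.simple i * p.1 * cs.simple i, p.2 + if p.1 = cs.simple i then 1 else 0)

theorem simple_mul_pow_simple_mul_simple (cs : CoxeterSystem M W) (i j : B) (n : ℕ) :
    cs.simple j * (cs.simple i * cs.simple j) ^ n =
      ((cs.simple i * cs.simple j) ^ n)⁻¹ * cs.simple j := by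
  have h : SemiconjBy (cs.simple j) (cs.simple i * cs.simple j) (cs.simple i * cs.simple j)⁻¹ := by
    simp [SemiconjBy, mul_assoc]
  simpa only [inv_pow] using (h.pow_right n).eq

open Classical in
theorem signedConj_mul_pow_apply (cs : CoxeterSystem M W) (i j : B) (n : ℕ) (t : W) (ε : ZMod 2) :
    ((signedConj cs i * signedConj cs j) ^ n) (t, ε) =
      ((cs.simple i * cs.simple j) ^ n * t * ((cs.simple i * cs.simple j) ^ n)⁻¹,
        ε + ∑ k ∈ Finset.range (2 * n),
          if t = ((cs.simple i * cs.simple j) ^ k)⁻¹ * cs.simple j then 1 else 0) := by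
  induction n with
  | zero => simp
  | succ n ih =>
    set g := cs.simple i * cs.simple j with hg
    have hj : ∀ m, cs.simple j * g ^ m = (g ^ m)⁻¹ * cs.simple j :=
      simple_mul_pow_simple_mul_simple cs i j
    have h1 : g ^ n * t * (g ^ n)⁻¹ = cs.simple j ↔ t = (g ^ (2 * n))⁻¹ * cs.simple j := by
      rw [two_mul, pow_add, mul_inv_rev, mul_assoc (g ^ n)⁻¹, ← hj n, mul_inv_eq_iff_eq_mul,
        eq_inv_mul_iff_mul_eq]
    have h2 : cs.simple j * (g ^ n * t * (g ^ n)⁻¹) * cs.simple j = cs.simple i ↔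
        t = (g ^ (2 * n + 1))⁻¹ * cs.simple j := by
      have e : (g ^ (2 * n + 1))⁻¹ * cs.simple j =
          (g ^ n)⁻¹ * (cs.simple j * cs.simple i * cs.simple j) * g ^ n := by
        have : cs.simple j * cs.simple i = g⁻¹ := by simp [hg]
        rw [this, mul_assoc _ _ (g ^ n), mul_assoc _ _ (g ^ n), hj, two_mul, pow_succ, pow_add]
        simp only [mul_inv_rev, mul_assoc]
        rw [← mul_assoc g⁻¹ (g ^ n)⁻¹, ← mul_assoc (g ^ n)⁻¹ g⁻¹, ← mul_inv_rev, ← mul_inv_rev,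
          (Commute.self_pow g n).eq]
      rw [e]
      constructor
      · intro h
        rw [← h]
        simp [mul_assoc]
      · rintro rfl
        simp [mul_assoc]
    rw [pow_succ', end_mul_apply, ih, end_mul_apply]
    simp only [signedConj]
    rw [show 2 * (n + 1) = 2 * n + 1 + 1 by ring, Finset.sum_range_succ, Finset.sum_range_succ]
    simp only [h1, h2, Prod.mk.injEq]
    refine ⟨?_, by ring⟩
    rw [pow_succ' g n]
    simp [hg, mul_assoc]

theorem signedConj_mul_pow_eq_one (cs : CoxeterSystem M W) {i j : B} {m : ℕ}
    (hm : (cs.simple i * cs.simple j) ^ m = 1) : (signedConj cs i * signedConj cs j) ^ m = 1 := by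
  classical
  funext ⟨t, ε⟩
  have h : ∀ x, (cs.simple i * cs.simple j) ^ (m + x) = (cs.simple i * cs.simple j) ^ x :=
    fun x ↦ by rw [pow_add, hm, one_mul]
  rw [signedConj_mul_pow_apply, two_mul, Finset.sum_range_add]
  simp_rw [h]
  rw [CharTwo.add_self_eq_zero, hm]
  simp

theorem isLiftable_signedConj (cs : CoxeterSystem M W) : M.IsLiftable (signedConj cs) :=
  fun i j ↦ signedConj_mul_pow_eq_one cs (cs.simple_mul_simple_pow i j)

/-- The parity of the number of times the wall of `t` is crossed on the way from `1` to `w`. -/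
noncomputable def crossingParity (cs : CoxeterSystem M W) (w t : W) : ZMod 2 :=
  (cs.lift ⟨signedConj cs, isLiftable_signedConj cs⟩ w⁻¹ (t, 0)).2

theorem lift_signedConj_apply (cs : CoxeterSystem M W) (w t : W) (ε : ZMod 2) :
    cs.lift ⟨signedConj cs, isLiftable_signedConj cs⟩ w (t, ε) =
      (w * t * w⁻¹, ε + crossingParity cs w⁻¹ t) := by
  suffices h : ∃ δ : ZMod 2, ∀ ε, cs.lift ⟨signedConj cs, isLiftable_signedConj cs⟩ w (t, ε) =
      (w * t * w⁻¹, ε + δ) by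
    obtain ⟨δ, hδ⟩ := h
    simp [crossingParity, hδ]
  induction w using cs.simple_induction_left with
  | one => exact ⟨0, fun ε ↦ by simp⟩
  | mul_simple_left w i ih =>
    obtain ⟨δ, hδ⟩ := ih
    classical
    refine ⟨δ + if w * t * w⁻¹ = cs.simple i then 1 else 0, fun ε ↦ ?_⟩
    rw [map_mul, end_mul_apply, hδ, cs.lift_apply_simple]
    simp [signedConj, mul_assoc, add_assoc]

theorem crossingParity_mul (cs : CoxeterSystem M W) (u v t : W) :
    crossingParity cs (u * v) t = crossingParity cs u t + crossingParity cs v (u⁻¹ * t * u) := by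
  have h := lift_signedConj_apply cs (v⁻¹ * u⁻¹) t 0
  rw [map_mul, end_mul_apply, lift_signedConj_apply,
    lift_signedConj_apply] at h
  simpa using (congrArg Prod.snd h).symm

open Classical in
theorem crossingParity_simple (cs : CoxeterSystem M W) (i : B) (t : W) :
    crossingParity cs (cs.simple i) t = if t = cs.simple i then 1 else 0 := by
  simp [crossingParity, cs.lift_apply_simple, signedConj]

@[simp]
theorem crossingParity_one (cs : CoxeterSystem M W) (t : W) : crossingParity cs 1 t = 0 := by
  simp [crossingParity]

theorem crossingParity_self (cs : CoxeterSystem M W) {t : W} (ht : cs.IsReflection t) :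
    crossingParity cs t t = 1 := by
  obtain ⟨w, i, rfl⟩ := ht
  have h := crossingParity_mul cs w w⁻¹ (w * cs.simple i * w⁻¹)
  rw [crossingParity_mul, crossingParity_mul, crossingParity_simple]
  simp only [mul_inv_cancel, crossingParity_one] at h
  simp [mul_assoc] at h ⊢
  linear_combination -h

theorem mem_leftInvSeq_of_crossingParity_ne_zero (cs : CoxeterSystem M W) (ω : List B) :
    ∀ t, crossingParity cs (cs.wordProd ω) t ≠ 0 → t ∈ cs.leftInvSeq ω := by
  induction ω with
  | nil => simp
  | cons i ω ih =>
    intro t ht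
    rw [cs.wordProd_cons, crossingParity_mul, crossingParity_simple] at ht
    rw [CoxeterSystem.leftInvSeq, List.mem_cons, List.mem_map]
    by_cases h : t = cs.simple i
    · exact .inl h
    · rw [if_neg h, zero_add] at ht
      exact .inr ⟨_, ih _ ht, by simp [mul_assoc]⟩

theorem exists_mul_wordProd_eq_eraseIdx (cs : CoxeterSystem M W) {ω : List B} {t : W}
    (h : crossingParity cs (cs.wordProd ω) t ≠ 0) :
    ∃ j < ω.length, t * cs.wordProd ω = cs.wordProd (ω.eraseIdx j) := by
  obtain ⟨j, hj, rfl⟩ := List.mem_iff_getElem.mp (mem_leftInvSeq_of_crossingParity_ne_zero cs ω t h)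
  refine ⟨j, by simpa using hj, ?_⟩
  rw [← List.getD_eq_getElem _ 1 hj, cs.getD_leftInvSeq_mul_wordProd]

theorem length_mul_lt_iff_crossingParity (cs : CoxeterSystem M W) {t : W}
    (ht : cs.IsReflection t) (w : W) :
    cs.length (t * w) < cs.length w ↔ crossingParity cs w t = 1 := by
  have key : ∀ w, crossingParity cs w t ≠ 0 → cs.length (t * w) < cs.length w := by
    intro w hw
    obtain ⟨ω, hω, rfl⟩ := cs.exists_isReduced w
    exact (cs.isLeftInversion_of_mem_leftInvSeq hω
      (mem_leftInvSeq_of_crossingParity_ne_zero cs ω t hw)).2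
  refine ⟨fun h ↦ ?_, fun h ↦ key w (by simp [h])⟩
  by_contra h1
  have h0 : crossingParity cs w t = 0 := by
    generalize crossingParity cs w t = a at h1
    revert a; decide
  have h2 := key (t * w) (by
    rw [crossingParity_mul, crossingParity_self cs ht]
    simp [h0])
  rw [← mul_assoc, ht.mul_self, one_mul] at h2
  exact lt_asymm h h2

theorem sameSide_iff_crossingParity_eq (cs : CoxeterSystem M W) {t : W} (ht : cs.IsReflection t)
    (u v : W) : SameSide cs t u v ↔ crossingParity cs u t = crossingParity cs v t := by
  rw [SameSide, length_mul_lt_iff_crossingParity cs ht, length_mul_lt_iff_crossingParity cs ht]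
  generalize crossingParity cs u t = a
  generalize crossingParity cs v t = b
  revert a b; decide

theorem exists_word_of_mem_closure (cs : CoxeterSystem M W) {I : Set B} {w : W}
    (hw : w ∈ Subgroup.closure (cs.simple '' I)) : ∃ ω : List B, (∀ i ∈ ω, i ∈ I) ∧
      cs.wordProd ω = w := by
  induction hw using Subgroup.closure_induction with
  | mem x hx =>
    obtain ⟨i, hi, rfl⟩ := hx
    exact ⟨[i], by simpa using hi, by simp⟩
  | one => exact ⟨[], by simp, by simp⟩
  | mul x y _ _ hx hy =>
    obtain ⟨ω, h, rfl⟩ := hx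
    obtain ⟨ω', h', rfl⟩ := hy
    refine ⟨ω ++ ω', fun i hi ↦ ?_, cs.wordProd_append ω ω'⟩
    exact (List.mem_append.mp hi).elim (h i) (h' i)
  | inv x _ hx =>
    obtain ⟨ω, h, rfl⟩ := hx
    exact ⟨ω.reverse, by simpa using h, by simp⟩

theorem wordProd_mem_closure (cs : CoxeterSystem M W) {I : Set B} {ω : List B}
    (h : ∀ i ∈ ω, i ∈ I) : cs.wordProd ω ∈ Subgroup.closure (cs.simple '' I) :=
  Subgroup.list_prod_mem _ fun x hx ↦ by
    obtain ⟨i, hi, rfl⟩ := List.mem_map.mp hx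
    exact Subgroup.subset_closure ⟨i, h i hi, rfl⟩

theorem mem_closure_of_crossingParity_ne_zero (cs : CoxeterSystem M W) {I : Set B} {w t : W}
    (hw : w ∈ Subgroup.closure (cs.simple '' I)) (h : crossingParity cs w t ≠ 0) :
    t ∈ Subgroup.closure (cs.simple '' I) := by
  obtain ⟨ω, hω, rfl⟩ := exists_word_of_mem_closure cs hw
  obtain ⟨j, -, hj⟩ := exists_mul_wordProd_eq_eraseIdx cs h
  rw [← eq_mul_inv_iff_mul_eq] at hj
  rw [hj]
  exact mul_mem (wordProd_mem_closure cs fun i hi ↦ hω i (List.mem_of_mem_eraseIdx hi))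
    (inv_mem hw)

/-- Lengths add when an element of a standard parabolic subgroup is multiplied on the left by a
shortest representative of a coset of that subgroup. -/
theorem exists_word_length_mul_eq (cs : CoxeterSystem M W) {I : Set B} {y : W}
    (hy : ∀ p ∈ Subgroup.closure (cs.simple '' I), cs.length y ≤ cs.length (y * p)) {w : W}
    (hw : w ∈ Subgroup.closure (cs.simple '' I)) :
    ∃ ω : List B, (∀ i ∈ ω, i ∈ I) ∧ cs.wordProd ω = w ∧
      cs.length (y * w) = cs.length y + ω.length := by
  obtain ⟨ω, hω, rfl⟩ := exists_word_of_mem_closure cs hw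
  clear hw
  induction ω using List.reverseRecOn with
  | nil => exact ⟨[], by simp⟩
  | append_singleton ω i ih =>
    obtain ⟨ω', hω', h1, h2⟩ := ih fun j hj ↦ hω j (by simp [hj])
    have hi : i ∈ I := hω i (by simp)
    rw [cs.wordProd_append, cs.wordProd_singleton, ← h1, ← mul_assoc]
    rw [← h1] at h2
    rcases cs.length_mul_simple (y * cs.wordProd ω') i with h | h
    · refine ⟨ω' ++ [i], ?_, by simp [cs.wordProd_append], by rw [h, h2]; simp [add_assoc]⟩
      intro j hj
      rcases List.mem_append.mp hj with hj | hj
      · exact hω' j hj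
      · rwa [List.mem_singleton.mp hj]
    · set w := cs.wordProd ω' with hw
      have hwI : w ∈ Subgroup.closure (cs.simple '' I) := wordProd_mem_closure cs hω'
      have hiI : cs.simple i ∈ Subgroup.closure (cs.simple '' I) :=
        Subgroup.subset_closure ⟨i, hi, rfl⟩
      have hρ : cs.IsReflection (y * w * cs.simple i * (y * w)⁻¹) := ⟨_, _, rfl⟩
      have e1 : y⁻¹ * (y * w * cs.simple i * (y * w)⁻¹) * y = w * cs.simple i * w⁻¹ := by
        simp [mul_assoc]
      have h3 : crossingParity cs (y * w) (y * w * cs.simple i * (y * w)⁻¹) = 1 := by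
        rw [← length_mul_lt_iff_crossingParity cs hρ, inv_mul_cancel_right]
        omega
      have h4 : crossingParity cs y (y * w * cs.simple i * (y * w)⁻¹) ≠ 1 := by
        rw [ne_eq, ← length_mul_lt_iff_crossingParity cs hρ, not_lt]
        have e2 : y * w * cs.simple i * (y * w)⁻¹ * y = y * (w * cs.simple i * w⁻¹) := by
          simp [mul_assoc]
        rw [e2]
        exact hy _ (mul_mem (mul_mem hwI hiI) (inv_mem hwI))
      have h5 : crossingParity cs w (w * cs.simple i * w⁻¹) ≠ 0 := by
        rw [crossingParity_mul, e1] at h3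
        intro h0
        rw [h0, add_zero] at h3
        exact h4 h3
      obtain ⟨j, hj, he⟩ := exists_mul_wordProd_eq_eraseIdx cs h5
      rw [← hw, inv_mul_cancel_right] at he
      refine ⟨ω'.eraseIdx j, fun k hk ↦ hω' k (List.mem_of_mem_eraseIdx hk), he.symm, ?_⟩
      rw [List.length_eraseIdx_of_lt hj]
      omega

theorem simple_mul_zpow_simple_mul_simple (cs : CoxeterSystem M W) (b c : B) (k : ℤ) :
    cs.simple b * (cs.simple b * cs.simple c) ^ k =
      (cs.simple b * cs.simple c) ^ (-k) * cs.simple b := by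
  have h : SemiconjBy (cs.simple b) (cs.simple b * cs.simple c) (cs.simple b * cs.simple c)⁻¹ := by
    simp [SemiconjBy, mul_assoc]
  simpa only [inv_zpow, zpow_neg] using (h.zpow_right k).eq

theorem mem_closure_pair (cs : CoxeterSystem M W) {b c : B} {w : W}
    (hw : w ∈ Subgroup.closure (cs.simple '' {b, c})) :
    ∃ k : ℤ, w = (cs.simple b * cs.simple c) ^ k ∨
      w = (cs.simple b * cs.simple c) ^ k * cs.simple b := by
  have hb := simple_mul_zpow_simple_mul_simple cs b c
  set g := cs.simple b * cs.simple c with hg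
  have hc : cs.simple c = g ^ (-1 : ℤ) * cs.simple b := by simp [hg, mul_assoc]
  obtain ⟨ω, hω, rfl⟩ := exists_word_of_mem_closure cs hw
  clear hw
  induction ω with
  | nil => exact ⟨0, by simp⟩
  | cons i ω ih =>
    obtain ⟨k, hk⟩ := ih fun j hj ↦ hω j (by simp [hj])
    rw [cs.wordProd_cons]
    have hi : i = b ∨ i = c := hω i (by simp)
    rcases hi with rfl | rfl
    · refine ⟨-k, hk.symm.imp (fun h ↦ ?_) fun h ↦ ?_⟩
      · rw [h, ← mul_assoc, hb]; simp
      · rw [h, hb]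
    · refine ⟨-1 - k, hk.symm.imp (fun h ↦ ?_) fun h ↦ ?_⟩
      · rw [h, hc, mul_assoc, ← mul_assoc (cs.simple b), hb, ← mul_assoc, ← mul_assoc,
          ← zpow_add]
        simp [sub_eq_add_neg]
      · rw [h, hc, mul_assoc, hb, ← mul_assoc, ← zpow_add, sub_eq_add_neg]

theorem finite_closure_pair (cs : CoxeterSystem M W) {b c : B}
    (h : IsOfFinOrder (cs.simple b * cs.simple c)) :
    (Subgroup.closure (cs.simple '' {b, c}) : Set W).Finite := by
  have hf : (Subgroup.zpowers (cs.simple b * cs.simple c) : Set W).Finite := h.finite_zpowers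
  refine (hf.union (hf.image (· * cs.simple b))).subset fun w hw ↦ ?_
  obtain ⟨k, rfl | rfl⟩ := mem_closure_pair cs hw
  · exact .inl ⟨k, rfl⟩
  · exact .inr ⟨_, ⟨k, rfl⟩, rfl⟩

/-- If an element of a dihedral parabolic subgroup, other than `1` and a given generator, conjugates
that generator to a generator, then this subgroup is finite. -/
theorem isOfFinOrder_of_conj_simple (cs : CoxeterSystem M W) {b c d : B} {z : W}
    (hz : z ∈ Subgroup.closure (cs.simple '' {b, c})) (hd : d ∈ ({b, c} : Set B))
    (h1 : z ≠ 1) (hzb : z ≠ cs.simple b) (h : z * cs.simple b * z⁻¹ = cs.simple d) :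
    IsOfFinOrder (cs.simple b * cs.simple c) := by
  have hb := simple_mul_zpow_simple_mul_simple cs b c
  obtain ⟨k, hk⟩ := mem_closure_pair cs hz
  set g := cs.simple b * cs.simple c with hg
  have hk0 : k ≠ 0 := by
    rintro rfl
    simp only [zpow_zero, one_mul] at hk
    tauto
  have h2 : g ^ k * cs.simple b * (g ^ k)⁻¹ = cs.simple d := by
    rcases hk with hk | hk
    · rwa [← hk]
    · rw [hk] at h
      simpa [mul_assoc] using h
  have h3 : cs.simple d = g ^ (2 * k) * cs.simple b := by
    rw [← h2, ← zpow_neg, mul_assoc, hb, ← mul_assoc, ← zpow_add]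
    congr 2; ring
  rw [isOfFinOrder_iff_zpow_eq_one]
  rcases hd with rfl | hd
  · exact ⟨2 * k, by simpa using hk0, by simpa using h3.symm⟩
  · rw [Set.mem_singleton_iff] at hd
    subst hd
    have hc : cs.simple d = g ^ (-1 : ℤ) * cs.simple b := by simp [hg, mul_assoc]
    rw [hc] at h3
    refine ⟨2 * k + 1, by omega, ?_⟩
    rw [zpow_add, ← mul_right_cancel h3, ← zpow_add]
    simp

/-- Two reflections, one of which separates two edges of the wall of the other one, lie in a
common conjugate of a finite dihedral parabolic subgroup. -/
theorem exists_conj_mem_finite_dihedral (cs : CoxeterSystem M W) {r t : W} (hrt : t ≠ r) :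
    ∀ (n : ℕ) (u v : W) (a b : B), cs.length (u⁻¹ * v) = n → r * u = u * cs.simple a →
      r * v = v * cs.simple b → crossingParity cs u t ≠ crossingParity cs v t →
      ∃ (y : W) (b c : B), b ≠ c ∧ IsOfFinOrder (cs.simple b * cs.simple c) ∧
        y⁻¹ * r * y ∈ Subgroup.closure (cs.simple '' {b, c}) ∧
        y⁻¹ * t * y ∈ Subgroup.closure (cs.simple '' {b, c}) := by
  intro n
  induction n using Nat.strong_induction_on with
  | _ n ih =>
  intro u v a b hn hu hv hsep
  set x := u⁻¹ * v with hx
  have hvx : v = u * x := by simp [hx]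
  have hsx : cs.simple a * x = x * cs.simple b := by
    have : cs.simple a = u⁻¹ * r * u := by rw [mul_assoc, hu]; simp
    rw [this, hx]
    simp only [mul_assoc, mul_inv_cancel_left, hv]
  rcases cs.length_mul_simple x b with hlen | hlen
  swap
  · refine ih (cs.length (x * cs.simple b)) (by omega) u (v * cs.simple b) a b ?_ hu ?_ ?_
    · rw [hx, mul_assoc]
    · rw [← mul_assoc, hv]
    · rw [crossingParity_mul, crossingParity_simple, if_neg, add_zero]
      · exact hsep
      · intro h
        apply hrt
        have h1 : r = v * cs.simple b * v⁻¹ := by rw [← hv]; simp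
        rw [h1, ← h]
        simp [mul_assoc]
  have hx1 : x ≠ 1 := by
    rintro h
    rw [hvx, h, mul_one] at hsep
    exact hsep rfl
  obtain ⟨c, hc⟩ := cs.exists_rightDescent_of_ne_one hx1
  have hbc : b ≠ c := by
    rintro rfl
    rw [CoxeterSystem.IsRightDescent] at hc
    omega
  set P := Subgroup.closure (cs.simple '' {b, c}) with hP
  have hbP : cs.simple b ∈ P := Subgroup.subset_closure ⟨b, by simp, rfl⟩
  have hcP : cs.simple c ∈ P := Subgroup.subset_closure ⟨c, by simp, rfl⟩
  obtain ⟨p, -, hp⟩ := (measure fun p : P ↦ cs.length (x * p)).wf.has_min Set.univ ⟨1, trivial⟩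
  have hpmin : ∀ q ∈ P, cs.length (x * p) ≤ cs.length (x * q) :=
    fun q hq ↦ not_lt.mp (hp ⟨q, hq⟩ trivial)
  obtain ⟨y, hy⟩ : ∃ y, y = x * (p : W) := ⟨_, rfl⟩
  obtain ⟨z, hz⟩ : ∃ z, z = (p : W)⁻¹ := ⟨_, rfl⟩
  have hzP : z ∈ P := hz ▸ inv_mem p.2
  have hxyz : x = y * z := by simp [hy, hz]
  have hymin : ∀ q ∈ P, cs.length y ≤ cs.length (y * q) := by
    intro q hq
    rw [hy, mul_assoc x]
    exact hpmin _ (mul_mem p.2 hq)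
  have hyx : cs.length y < cs.length x :=
    lt_of_le_of_lt (by rw [hy]; exact hpmin _ hcP) hc
  have hay : cs.simple a * y = y * (z * cs.simple b * z⁻¹) := by
    rw [hxyz] at hsx
    rw [← mul_left_inj z, mul_assoc, hsx]
    simp [mul_assoc]
  obtain ⟨d, hd, hzd⟩ : ∃ d ∈ ({b, c} : Set B), z * cs.simple b * z⁻¹ = cs.simple d := by
    obtain ⟨ω, hω, h1, h2⟩ := exists_word_length_mul_eq cs hymin
      (mul_mem (mul_mem hzP hbP) (inv_mem hzP))
    rw [← hay] at h2
    have h3 : ω.length ≤ 1 := by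
      rcases cs.length_simple_mul y a with h | h <;> omega
    match ω, hω, h1, h3 with
    | [], _, h1, _ =>
      rw [cs.wordProd_nil, eq_comm, mul_inv_eq_one, mul_eq_left] at h1
      have := cs.length_simple b
      rw [h1, cs.length_one] at this
      omega
    | [d], hω, h1, _ => exact ⟨d, hω d (by simp), by rw [← h1, cs.wordProd_singleton]⟩
  have hfin : IsOfFinOrder (cs.simple b * cs.simple c) := by
    refine isOfFinOrder_of_conj_simple cs hzP hd ?_ ?_ hzd
    · rintro rfl
      rw [hxyz, mul_one] at hyx
      exact lt_irrefl _ hyx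
    · intro h
      rw [h] at hxyz
      rw [hxyz, cs.simple_mul_simple_cancel_right, ← hxyz] at hlen
      omega
  have hruy : r * (u * y) = u * y * cs.simple d := by
    rw [← mul_assoc, hu, mul_assoc, hay, hzd, mul_assoc]
  by_cases hsep' : crossingParity cs u t = crossingParity cs (u * y) t
  · refine ⟨u * y, b, c, hbc, hfin, ?_, ?_⟩
    · rw [mul_assoc, hruy, inv_mul_cancel_left]
      exact Subgroup.subset_closure ⟨d, hd, rfl⟩
    · refine mem_closure_of_crossingParity_ne_zero cs hzP fun h ↦ hsep ?_
      rw [hvx, hxyz, ← mul_assoc, crossingParity_mul, h, add_zero, hsep']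
  · refine ih (cs.length y) (by omega) u (u * y) a d (by simp) hu hruy hsep'

theorem Crosses.exists_conj_mem_finite_dihedral {cs : CoxeterSystem M W} {r t : W}
    (hr : cs.IsReflection r) (ht : cs.IsReflection t) (h : Crosses cs r t) :
    ∃ (y : W) (b c : B), b ≠ c ∧ IsOfFinOrder (cs.simple b * cs.simple c) ∧
      y⁻¹ * r * y ∈ Subgroup.closure (cs.simple '' {b, c}) ∧
      y⁻¹ * t * y ∈ Subgroup.closure (cs.simple '' {b, c}) := by
  obtain ⟨hne, hpar⟩ := h
  simp only [Parallel, not_and_or, not_forall] at hpar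
  rcases hpar with h | ⟨u, v, ⟨a, hu⟩, ⟨b, hv⟩, huv⟩ | ⟨u, v, ⟨a, hu⟩, ⟨b, hv⟩, huv⟩
  · exact absurd hne h
  · rw [sameSide_iff_crossingParity_eq cs hr] at huv
    obtain ⟨y, b, c, hbc, hfin, h1, h2⟩ :=
      CoxTrack.exists_conj_mem_finite_dihedral cs hne _ u v a b rfl hu hv huv
    exact ⟨y, b, c, hbc, hfin, h2, h1⟩
  · rw [sameSide_iff_crossingParity_eq cs ht] at huv
    exact CoxTrack.exists_conj_mem_finite_dihedral cs hne.symm _ u v a b rfl hu hv huv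

section Representation

variable [Fintype B] [DecidableEq B]

/-- The reflection of the canonical representation attached to a generator of a Coxeter matrix. -/
noncomputable def geomReflection (M : CoxeterMatrix B) (i : B) : Module.End ℝ (B → ℝ) :=
  LinearMap.id - (2 : ℝ) • LinearMap.smulRight
    (∑ j, (-Real.cos (Real.pi / M i j)) •
      (LinearMap.proj j : (B → ℝ) →ₗ[ℝ] ℝ)) (Pi.single i (1 : ℝ))

theorem geomReflection_apply (M : CoxeterMatrix B) (i : B) (v : B → ℝ) :
    geomReflection M i v =
      v - (2 * ∑ j, -Real.cos (Real.pi / M i j) * v j) • Pi.single i (1 : ℝ) := by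
  simp [geomReflection, smul_smul, LinearMap.sum_apply]

theorem geomReflection_single (M : CoxeterMatrix B) (i j : B) :
    geomReflection M i (Pi.single j 1) =
      Pi.single j 1 + (2 * Real.cos (Real.pi / M i j)) • Pi.single i (1 : ℝ) := by
  rw [geomReflection_apply, Finset.sum_eq_single j]
  · simp [sub_eq_add_neg, neg_smul]
  · intro k _ hk
    simp [hk]
  · simp

theorem geomReflection_single_self (M : CoxeterMatrix B) (i : B) :
    geomReflection M i (Pi.single i 1) = -Pi.single i (1 : ℝ) := by
  rw [geomReflection_single, M.diagonal]
  simp only [Nat.cast_one, div_one, Real.cos_pi]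
  module

theorem geomReflection_mul_self (M : CoxeterMatrix B) (i : B) :
    geomReflection M i * geomReflection M i = 1 := by
  ext1 j
  ext1
  simp only [LinearMap.comp_apply, Module.End.mul_apply, LinearMap.single_apply,
    Module.End.one_apply]
  rw [geomReflection_single, map_add, map_smul, geomReflection_single_self, geomReflection_single]
  module

open Polynomial.Chebyshev

theorem geomReflection_mul_pow_single (M : CoxeterMatrix B) (b c : B) (k : ℕ) :
    ((geomReflection M b * geomReflection M c) ^ k) (Pi.single b 1) =
        (U ℝ (2 * k)).eval (Real.cos (Real.pi / M b c)) • Pi.single b (1 : ℝ) +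
        (U ℝ (2 * k - 1)).eval (Real.cos (Real.pi / M b c)) • Pi.single c (1 : ℝ) ∧
      ((geomReflection M b * geomReflection M c) ^ k) (Pi.single c 1) =
        -(U ℝ (2 * k - 1)).eval (Real.cos (Real.pi / M b c)) • Pi.single b (1 : ℝ) -
        (U ℝ (2 * k - 2)).eval (Real.cos (Real.pi / M b c)) • Pi.single c (1 : ℝ) := by
  set x := Real.cos (Real.pi / M b c) with hx
  have hrec : ∀ n : ℤ, (U ℝ (n + 2)).eval x = 2 * x * (U ℝ (n + 1)).eval x - (U ℝ n).eval x := by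
    intro n
    rw [U_add_two]
    simp
  have hgc : (geomReflection M b * geomReflection M c) (Pi.single c 1) =
      -Pi.single c (1 : ℝ) - (2 * x) • Pi.single b (1 : ℝ) := by
    rw [Module.End.mul_apply, geomReflection_single_self, map_neg, geomReflection_single, ← hx]
    module
  have hgb : (geomReflection M b * geomReflection M c) (Pi.single b 1) =
      (4 * x ^ 2 - 1) • Pi.single b (1 : ℝ) + (2 * x) • Pi.single c (1 : ℝ) := by
    rw [Module.End.mul_apply, geomReflection_single, map_add, map_smul,
      geomReflection_single_self, geomReflection_single, M.symmetric c b, ← hx]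
    module
  have hs : ∀ (k : ℕ) (v : B → ℝ), ((geomReflection M b * geomReflection M c) ^ (k + 1)) v =
      (geomReflection M b * geomReflection M c)
        (((geomReflection M b * geomReflection M c) ^ k) v) := by
    intro k v
    rw [pow_succ', Module.End.mul_apply]
  induction k with
  | zero => simp
  | succ k ih =>
    have e2 := hrec (2 * k)
    have e1 := hrec (2 * k - 1)
    have e0 := hrec (2 * k - 2)
    rw [show (2 * k - 1 + 2 : ℤ) = 2 * k + 1 by ring,
      show (2 * k - 1 + 1 : ℤ) = 2 * k by ring] at e1
    rw [show (2 * k - 2 + 2 : ℤ) = 2 * k by ring,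
      show (2 * k - 2 + 1 : ℤ) = 2 * k - 1 by ring] at e0
    rw [hs, hs, ih.1, ih.2, map_add, map_sub,
      map_smul, map_smul, map_smul, map_smul, hgb, hgc]
    push_cast
    rw [show (2 * (k + 1) : ℤ) = 2 * k + 2 by ring, show (2 * k + 2 - 1 : ℤ) = 2 * k + 1 by ring,
      show (2 * k + 2 - 2 : ℤ) = 2 * k by ring, e2, e1]
    constructor
    · module
    · rw [e0]
      module

theorem geomReflection_mul_pow_apply_of_ne (M : CoxeterMatrix B) {b c i : B} (hb : i ≠ b)
    (hc : i ≠ c) (k : ℕ) (v : B → ℝ) :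
    ((geomReflection M b * geomReflection M c) ^ k) v i = v i := by
  induction k with
  | zero => simp
  | succ k ih =>
    rw [pow_succ', Module.End.mul_apply, Module.End.mul_apply, geomReflection_apply,
      geomReflection_apply M c]
    simp [hb, hc, ih]

theorem sin_pi_div_pos {m : ℕ} (hm : 2 ≤ m) : 0 < Real.sin (Real.pi / m) := by
  have h2 : (2 : ℝ) ≤ m := by exact_mod_cast hm
  apply Real.sin_pos_of_pos_of_lt_pi
  · positivity
  · exact div_lt_self Real.pi_pos (by linarith)

theorem geomReflection_mul_pow_eq_one (M : CoxeterMatrix B) (b c : B) :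
    (geomReflection M b * geomReflection M c) ^ M b c = 1 := by
  by_cases hbc : b = c
  · subst hbc
    rw [M.diagonal, pow_one, geomReflection_mul_self]
  by_cases h0 : M b c = 0
  · rw [h0, pow_zero]
  have hm : 2 ≤ M b c := by
    have := M.off_diagonal b c hbc
    omega
  set x := Real.cos (Real.pi / M b c) with hx
  have hsin := sin_pi_div_pos hm
  have hU : ∀ n : ℤ, (U ℝ n).eval x = Real.sin ((n + 1) * (Real.pi / M b c)) /
      Real.sin (Real.pi / M b c) := by
    intro n
    rw [eq_div_iff hsin.ne', U_real_cos]
  have hm0 : (M b c : ℝ) ≠ 0 := by exact_mod_cast h0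
  have hθ : (2 * (M b c : ℝ)) * (Real.pi / M b c) = 2 * Real.pi := by field_simp
  have u0 : (U ℝ (2 * M b c)).eval x = 1 := by
    rw [hU]
    push_cast
    rw [add_mul, hθ, one_mul, add_comm, Real.sin_add_two_pi, div_self hsin.ne']
  have u1 : (U ℝ (2 * M b c - 1)).eval x = 0 := by
    rw [hU]
    push_cast
    rw [sub_add_cancel, hθ, Real.sin_two_pi, zero_div]
  have u2 : (U ℝ (2 * M b c - 2)).eval x = -1 := by
    rw [hU]
    push_cast
    rw [show (2 * (M b c : ℝ) - 2 + 1) * (Real.pi / M b c) =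
      2 * (M b c : ℝ) * (Real.pi / M b c) - Real.pi / M b c by ring, hθ,
      Real.sin_two_pi_sub, neg_div, div_self hsin.ne']
  obtain ⟨hb, hc⟩ := geomReflection_mul_pow_single M b c (M b c)
  rw [← hx, u0, u1, one_smul, zero_smul, add_zero] at hb
  rw [← hx, u1, u2, neg_zero, zero_smul, zero_sub, neg_smul, neg_neg, one_smul] at hc
  have hx1 : 1 - x ^ 2 ≠ 0 := by
    rw [hx, ← Real.sin_sq]
    positivity
  refine LinearMap.ext fun z ↦ ?_
  set f : B → ℝ := fun i ↦ ∑ j, -Real.cos (Real.pi / M i j) * z j with hf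
  set p : B → ℝ := ((f b + x * f c) / (1 - x ^ 2)) • Pi.single b 1 +
    ((f c + x * f b) / (1 - x ^ 2)) • Pi.single c 1 with hp
  have hrefl : ∀ i, geomReflection M i z = z - (2 * f i) • Pi.single i (1 : ℝ) :=
    fun i ↦ geomReflection_apply M i z
  have hqb : geomReflection M b (z - p) = z - p := by
    rw [map_sub, hrefl, hp, map_add, map_smul, map_smul, geomReflection_single_self,
      geomReflection_single, ← hx]
    match_scalars <;> field_simp
    ring
  have hqc : geomReflection M c (z - p) = z - p := by
    rw [map_sub, hrefl, hp, map_add, map_smul, map_smul, geomReflection_single_self,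
      geomReflection_single, M.symmetric c b, ← hx]
    match_scalars <;> field_simp
    ring
  have hq : ∀ k : ℕ, ((geomReflection M b * geomReflection M c) ^ k) (z - p) = z - p := by
    intro k
    induction k with
    | zero => simp
    | succ k ih => rw [pow_succ', Module.End.mul_apply, ih, Module.End.mul_apply, hqc, hqb]
  have h := hq (M b c)
  rw [map_sub] at h
  have hpp : ((geomReflection M b * geomReflection M c) ^ M b c) p = p := by
    rw [hp, map_add, map_smul, map_smul, hb, hc]
  rw [hpp] at h
  simpa using h

/-- The canonical linear representation of a Coxeter group. -/
noncomputable def geomRep (cs : CoxeterSystem M W) : W →* Module.End ℝ (B → ℝ) :=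
  cs.lift ⟨geomReflection M, geomReflection_mul_pow_eq_one M⟩

theorem geomRep_simple (cs : CoxeterSystem M W) (i : B) :
    geomRep cs (cs.simple i) = geomReflection M i :=
  cs.lift_apply_simple _ i

theorem trace_geomReflection_mul_pow (M : CoxeterMatrix B) {b c : B} (hbc : b ≠ c) (k : ℕ) :
    LinearMap.trace ℝ (B → ℝ) ((geomReflection M b * geomReflection M c) ^ k) =
      Fintype.card B - 2 + ((U ℝ (2 * k)).eval (Real.cos (Real.pi / M b c)) -
        (U ℝ (2 * k - 2)).eval (Real.cos (Real.pi / M b c))) := by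
  rw [LinearMap.trace_eq_matrix_trace ℝ (Pi.basisFun ℝ B), Matrix.trace]
  obtain ⟨hb, hc⟩ := geomReflection_mul_pow_single M b c k
  have hdiag : ∀ i, (LinearMap.toMatrix (Pi.basisFun ℝ B) (Pi.basisFun ℝ B)
      ((geomReflection M b * geomReflection M c) ^ k)).diag i =
      1 + (if i = b then (U ℝ (2 * k)).eval (Real.cos (Real.pi / M b c)) - 1 else 0) +
      (if i = c then -(U ℝ (2 * k - 2)).eval (Real.cos (Real.pi / M b c)) - 1 else 0) := by
    intro i
    rw [Matrix.diag_apply, LinearMap.toMatrix_apply, Pi.basisFun_apply, Pi.basisFun_repr]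
    by_cases h1 : i = b
    · subst h1
      rw [hb]
      simp [hbc]
    by_cases h2 : i = c
    · subst h2
      rw [hc]
      simp [h1]
    · rw [geomReflection_mul_pow_apply_of_ne M h1 h2]
      simp [h1, h2]
  simp only [hdiag, Finset.sum_add_distrib, Finset.sum_ite_eq', Finset.mem_univ, if_true,
    Finset.sum_const, Finset.card_univ, nsmul_eq_mul]
  ring

theorem coxeterMatrix_ne_zero_of_isOfFinOrder (cs : CoxeterSystem M W) {b c : B} (hbc : b ≠ c)
    (h : IsOfFinOrder (cs.simple b * cs.simple c)) : M b c ≠ 0 := by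
  intro h0
  obtain ⟨n, hn, hg⟩ := isOfFinOrder_iff_pow_eq_one.mp h
  have h1 := congrArg (geomRep cs) hg
  rw [map_pow, map_mul, geomRep_simple, geomRep_simple, map_one] at h1
  have h2 := (geomReflection_mul_pow_single M b c n).1
  rw [h1] at h2
  have h3 := congrFun h2 b
  simp only [h0, Nat.cast_zero, div_zero, Real.cos_zero, U_eval_one] at h3
  simp [hbc] at h3
  omega

/-- In the canonical representation, only the identity among the powers of a product of two
generators of finite order has the trace of the identity. -/
theorem pow_eq_one_of_trace_geomRep (cs : CoxeterSystem M W) {b c : B} (hbc : b ≠ c)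
    (h : IsOfFinOrder (cs.simple b * cs.simple c)) {k : ℕ}
    (hk : LinearMap.trace ℝ (B → ℝ) (geomRep cs ((cs.simple b * cs.simple c) ^ k)) =
      Fintype.card B) : (cs.simple b * cs.simple c) ^ k = 1 := by
  have h0 := coxeterMatrix_ne_zero_of_isOfFinOrder cs hbc h
  have hm : 2 ≤ M b c := by
    have := M.off_diagonal b c hbc
    omega
  have hsin := sin_pi_div_pos hm
  rw [map_pow, map_mul, geomRep_simple, geomRep_simple, trace_geomReflection_mul_pow M hbc] at hk
  set θ := Real.pi / M b c with hθ
  have e1 := U_real_cos θ (2 * k)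
  have e2 := U_real_cos θ (2 * k - 2)
  push_cast at e1 e2
  rw [show (2 * (k : ℝ) + 1) * θ = 2 * k * θ + θ by ring, Real.sin_add] at e1
  rw [show (2 * (k : ℝ) - 2 + 1) * θ = 2 * k * θ - θ by ring, Real.sin_sub] at e2
  have hcos : Real.cos (2 * k * θ) = 1 := by
    apply mul_right_cancel₀ hsin.ne'
    linear_combination (e2 - e1) / 2 + Real.sin θ / 2 * hk
  obtain ⟨n, hn⟩ := (Real.cos_eq_one_iff _).mp hcos
  have hm0 : (M b c : ℝ) ≠ 0 := by exact_mod_cast h0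
  have hkn : (k : ℝ) = n * M b c := by
    rw [hθ] at hn
    field_simp at hn
    linarith
  have hkn' : (k : ℤ) = M b c * n := by
    rw [mul_comm]
    exact_mod_cast hkn
  rw [← zpow_natCast, hkn', zpow_mul, zpow_natCast, cs.simple_mul_simple_pow, one_zpow]

end Representation


theorem lengthParity_eq_of_isReflection {cs : CoxeterSystem M W} {t : W}
    (ht : cs.IsReflection t) : cs.lengthParity t = Multiplicative.ofAdd 1 := by
  obtain ⟨w, i, rfl⟩ := ht
  rw [map_mul, map_mul, map_inv, cs.lengthParity_simple, mul_right_comm, mul_inv_cancel, one_mul]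

theorem exists_eq_pow_of_mem_closure_pair (cs : CoxeterSystem M W) {b c : B}
    (h : IsOfFinOrder (cs.simple b * cs.simple c)) {w : W}
    (hw : w ∈ Subgroup.closure (cs.simple '' {b, c})) (hpar : cs.lengthParity w = 1) :
    ∃ k : ℕ, w = (cs.simple b * cs.simple c) ^ k := by
  have hg : cs.lengthParity (cs.simple b * cs.simple c) = 1 := by
    rw [map_mul, cs.lengthParity_simple, cs.lengthParity_simple]
    decide
  obtain ⟨k, rfl | rfl⟩ := mem_closure_pair cs hw
  · obtain ⟨n, hn⟩ := h.mem_powers_iff_mem_zpowers.mpr ⟨k, rfl⟩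
    exact ⟨n, hn.symm⟩
  · rw [map_mul, map_zpow, hg, one_zpow, one_mul, cs.lengthParity_simple] at hpar
    exact absurd hpar (by decide)

theorem exists_finset_trace_geomRep_mem [Fintype B] [DecidableEq B] (cs : CoxeterSystem M W) :
    ∃ K : Finset ℝ, (Fintype.card B : ℝ) ∉ K ∧ ∀ r t : W, cs.IsReflection r →
      cs.IsReflection t → Crosses cs r t →
      LinearMap.trace ℝ (B → ℝ) (geomRep cs r * geomRep cs t) ∈ K := by
  have hfin : (⋃ (q : B × B) (_ : IsOfFinOrder (cs.simple q.1 * cs.simple q.2)),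
      (fun w ↦ LinearMap.trace ℝ (B → ℝ) (geomRep cs w)) ''
        (Subgroup.closure (cs.simple '' {q.1, q.2}) : Set W)).Finite :=
    Set.finite_iUnion fun q ↦ Set.finite_iUnion fun h ↦ (finite_closure_pair cs h).image _
  refine ⟨hfin.toFinset.erase (Fintype.card B), Finset.notMem_erase _ _, fun r t hr ht h ↦ ?_⟩
  obtain ⟨y, b, c, hbc, hg, h1, h2⟩ := h.exists_conj_mem_finite_dihedral hr ht
  have hp : y⁻¹ * (r * t) * y ∈ Subgroup.closure (cs.simple '' {b, c}) := by
    have := mul_mem h1 h2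
    rwa [show y⁻¹ * r * y * (y⁻¹ * t * y) = y⁻¹ * (r * t) * y by simp [mul_assoc]] at this
  have htr : LinearMap.trace ℝ (B → ℝ) (geomRep cs r * geomRep cs t) =
      LinearMap.trace ℝ (B → ℝ) (geomRep cs (y⁻¹ * (r * t) * y)) := by
    rw [map_mul (geomRep cs) _ y, LinearMap.trace_mul_comm ℝ _ (geomRep cs y), ← map_mul,
      ← map_mul, mul_inv_cancel_left]
  rw [Finset.mem_erase, Set.Finite.mem_toFinset, htr]
  refine ⟨fun hn ↦ h.1 ?_, Set.mem_iUnion₂.mpr ⟨(b, c), hg, _, hp, rfl⟩⟩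
  have hpar : cs.lengthParity (y⁻¹ * (r * t) * y) = 1 := by
    rw [map_mul, mul_comm, ← map_mul, mul_inv_cancel_left, map_mul,
      lengthParity_eq_of_isReflection hr,
      lengthParity_eq_of_isReflection ht]
    decide
  obtain ⟨k, hk⟩ := exists_eq_pow_of_mem_closure_pair cs hg hp hpar
  rw [hk] at hn
  have h3 := pow_eq_one_of_trace_geomRep cs hbc hg hn
  rw [← hk, mul_eq_one_iff_eq_inv, mul_eq_left, mul_eq_one_iff_eq_inv, ht.inv] at h3
  exact h3

/-- A family of linear functionals on a finite-dimensional space whose off-diagonal values at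
given points lie in a finite set missing all the diagonal values has bounded cardinality. -/
theorem exists_card_le_of_apply_mem {ι E : Type*} [AddCommGroup E] [Module ℝ E]
    [FiniteDimensional ℝ E] (K : Finset ℝ) (f : ι → Module.Dual ℝ E) (x : ι → E) :
    ∃ F : ℕ, ∀ T : Finset ι, (∀ r ∈ T, f r (x r) ∉ K) →
      (∀ r ∈ T, ∀ t ∈ T, r ≠ t → f r (x t) ∈ K) → T.card ≤ F := by
  classical
  let coe : Module.Dual ℝ E →ₗ[ℝ] E → ℝ :=
    { toFun := fun f ↦ f, map_add' := fun _ _ ↦ rfl, map_smul' := fun _ _ ↦ rfl }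
  let A : Submodule ℝ (E → ℝ) := 1 ⊔ LinearMap.range coe
  have h1 : (1 : Submodule ℝ (E → ℝ)).FG := by
    rw [Submodule.one_eq_span]
    exact Submodule.fg_span_singleton 1
  have hA : (A ^ K.card).FG :=
    (h1.sup (LinearMap.range_eq_map coe ▸ Module.Finite.fg_top.map coe)).pow _
  have : Module.Finite ℝ ↥(A ^ K.card) := Module.Finite.iff_fg.mpr hA
  have hmem : ∀ (r : ι) (L : Finset ℝ), ∏ k ∈ L, (coe (f r) - fun _ ↦ k) ∈ A ^ L.card := by
    intro r L
    induction L using Finset.induction_on with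
    | empty => simp
    | insert a L ha ih =>
      rw [Finset.prod_insert ha, Finset.card_insert_of_notMem ha, pow_succ']
      refine Submodule.mul_mem_mul (sub_mem ?_ ?_) ih
      · exact Submodule.mem_sup_right ⟨f r, rfl⟩
      · exact Submodule.mem_sup_left (Submodule.mem_one.mpr ⟨a, rfl⟩)
  refine ⟨Module.finrank ℝ ↥(A ^ K.card), fun T hd ho ↦ ?_⟩
  let φ : T → ↥(A ^ K.card) := fun r ↦ ⟨_, hmem r K⟩
  have hφ : ∀ r t : T, (φ r : E → ℝ) (x t) = ∏ k ∈ K, (f r (x t) - k) := by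
    intro r t
    simp [φ, coe, Finset.prod_apply]
  have hli : LinearIndependent ℝ φ := by
    rw [Fintype.linearIndependent_iff]
    intro g hg t
    have h2 := congrFun (congrArg Subtype.val hg) (x t)
    rw [Submodule.coe_sum, Finset.sum_apply, Finset.sum_eq_single t] at h2
    · rw [Submodule.coe_smul, Pi.smul_apply, hφ, smul_eq_mul] at h2
      refine (mul_eq_zero.mp h2).resolve_right (Finset.prod_ne_zero_iff.mpr fun k hk h ↦ ?_)
      rw [sub_eq_zero] at h
      exact hd t t.2 (h ▸ hk)
    · intro r _ hrt
      rw [Submodule.coe_smul, Pi.smul_apply, hφ, Finset.prod_eq_zero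
        (ho r r.2 t t.2 (Subtype.coe_injective.ne hrt)) (sub_self _), smul_zero]
    · simp
  simpa using hli.fintype_card_le_finrank

/-- (Brink–Howlett) There is a constant `F`, depending only on `(W,S)`, bounding the
cardinality of any collection of pairwise crossing walls of `Λ(W,S)`. -/
theorem antichain_bound {B : Type*} {W : Type*} [Group W] [Finite B]
    {M : CoxeterMatrix B} (cs : CoxeterSystem M W) :
    ∃ F : ℕ, ∀ T : Finset W, (∀ t ∈ T, cs.IsReflection t) →
      (∀ t ∈ T, ∀ t' ∈ T, t ≠ t' → Crosses cs t t') → T.card ≤ F := by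
  classical
  have := Fintype.ofFinite B
  obtain ⟨K, hK, h⟩ := exists_finset_trace_geomRep_mem cs
  obtain ⟨F, hF⟩ := exists_card_le_of_apply_mem K
    (fun w ↦ LinearMap.trace ℝ (B → ℝ) ∘ₗ LinearMap.mulLeft ℝ (geomRep cs w))
    fun w ↦ geomRep cs w
  refine ⟨F, fun T hT hc ↦ hF T (fun r hr ↦ ?_) fun r hr t ht hrt ↦
    h r t (hT r hr) (hT t ht) (hc r hr t ht hrt)⟩
  rw [LinearMap.comp_apply, LinearMap.mulLeft_apply, ← map_mul, (hT r hr).mul_self, map_one,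
    LinearMap.trace_one, Module.finrank_fintype_fun_eq_card]
  exact hK

end CoxTrack
end

section
/- Let (W,S) be a finitely generated Coxeter system with Cayley graph Λ(W,S), and let F be a bound on the number of pairwise crossing walls of Λ. For any vertices x and y of Λ, the set of walls separating x and y can be partitioned into at most F subsets, each of which consists of pairwise parallel walls. -/
/-!
Common definitions: Cayley graph of a Coxeter system, walls, sides,
bracket numbers, edge paths, quasi-geodesics, tracking.
-/

namespace CoxTrack

variable {B : Type*} {W : Type*} [Group W] {M : CoxeterMatrix B}

/-- **Dilworth's theorem**: a finite set in a partial order whose antichains have at most `k`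
elements can be coloured with `k` colours so that every colour class is a chain. -/
theorem exists_chain_coloring_of_antichain_card_le {α : Type*} [PartialOrder α] (k : ℕ)
    (s : Finset α)
    (h : ∀ A ⊆ s, IsAntichain (· ≤ ·) (A : Set α) → A.card ≤ k) :
    ∃ c : α → ℕ, (∀ a ∈ s, c a < k) ∧
      ∀ a ∈ s, ∀ b ∈ s, c a = c b → a ≤ b ∨ b ≤ a := by
  classical
  induction hn : s.card using Nat.strong_induction_on generalizing k s with
  | _ n ih =>
  subst hn
  rcases s.eq_empty_or_nonempty with rfl | hs
  · exact ⟨fun _ => 0, by simp, by simp⟩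
  obtain ⟨a, ha⟩ := s.exists_maximal hs
  have has : a ∈ s := ha.1
  have hk : 1 ≤ k := by simpa using h {a} (by simpa using has) (by simp)
  -- removing a chain that meets every antichain of size `k` lets us induct on `k - 1`
  have remove_chain : ∀ K ⊆ s, a ∈ K → (∀ b ∈ K, ∀ c ∈ K, b ≤ c ∨ c ≤ b) →
      (∀ A ⊆ s \ K, IsAntichain (· ≤ ·) (A : Set α) → A.card ≠ k) →
      ∃ c : α → ℕ, (∀ a ∈ s, c a < k) ∧
        ∀ a ∈ s, ∀ b ∈ s, c a = c b → a ≤ b ∨ b ≤ a := by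
    intro K hKs haK hK hA
    have hlt : (s \ K).card < s.card :=
      Finset.card_lt_card ⟨Finset.sdiff_subset, fun hsub => (Finset.mem_sdiff.1 (hsub has)).2 haK⟩
    obtain ⟨c, hc, hc'⟩ := ih _ hlt (k - 1) (s \ K) (fun A hAs hAa => by
      have := h A (hAs.trans Finset.sdiff_subset) hAa
      have := hA A hAs hAa
      omega) rfl
    refine ⟨fun z => if z ∈ K then k - 1 else c z, fun z hz => ?_, fun z hz w hw hzw => ?_⟩
    · dsimp only
      split_ifs with hzK
      · omega
      · have := hc z (Finset.mem_sdiff.2 ⟨hz, hzK⟩)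
        omega
    · dsimp only at hzw
      split_ifs at hzw with hzK hwK hwK
      · exact hK z hzK w hwK
      · have := hc w (Finset.mem_sdiff.2 ⟨hw, hwK⟩)
        omega
      · have := hc z (Finset.mem_sdiff.2 ⟨hz, hzK⟩)
        omega
      · exact hc' z (Finset.mem_sdiff.2 ⟨hz, hzK⟩) w (Finset.mem_sdiff.2 ⟨hw, hwK⟩) hzw
  by_cases hex : ∃ A ⊆ s.erase a, IsAntichain (· ≤ ·) (A : Set α) ∧ A.card = k
  swap
  · refine remove_chain {a} (by simpa using has) (by simp) (by simp) fun A hAs hAa hAk => hex ?_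
    exact ⟨A, by rwa [Finset.erase_eq], hAa, hAk⟩
  obtain ⟨A₀, hA₀s, hA₀a, hA₀k⟩ := hex
  obtain ⟨c, hc, hc'⟩ := ih _ (Finset.card_erase_lt_of_mem has) k (s.erase a)
    (fun A hAs hAa => h A (hAs.trans (Finset.erase_subset _ _)) hAa) rfl
  have hits : ∀ A ⊆ s.erase a, IsAntichain (· ≤ ·) (A : Set α) → A.card = k →
      ∀ i < k, ∃ z ∈ A, c z = i := by
    intro A hAs hAa hAk i hi
    have hinj : Set.InjOn c (A : Set α) := fun z hz w hw hzw => by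
      rcases hc' z (hAs hz) w (hAs hw) hzw with hle | hle
      · exact hAa.eq hz hw hle
      · exact (hAa.eq hw hz hle).symm
    have himg : A.image c = Finset.range k := by
      refine Finset.eq_of_subset_of_card_le (fun j hj => ?_) ?_
      · obtain ⟨z, hz, rfl⟩ := Finset.mem_image.1 hj
        exact Finset.mem_range.2 (hc z (hAs hz))
      · rw [Finset.card_image_of_injOn hinj, hAk, Finset.card_range]
    exact Finset.mem_image.1 (himg.symm ▸ Finset.mem_range.2 hi)
  have top : ∀ i, ∃ x, i < k → x ∈ s.erase a ∧ c x = i ∧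
      (∃ A ⊆ s.erase a, IsAntichain (· ≤ ·) (A : Set α) ∧ A.card = k ∧ x ∈ A) ∧
      ∀ A ⊆ s.erase a, IsAntichain (· ≤ ·) (A : Set α) → A.card = k →
        ∀ z ∈ A, c z = i → z ≤ x := by
    intro i
    by_cases hi : i < k
    swap
    · exact ⟨a, fun hik => absurd hik hi⟩
    obtain ⟨z₀, hz₀, hz₀i⟩ := hits A₀ hA₀s hA₀a hA₀k i hi
    obtain ⟨x, hx⟩ := ((s.erase a).filter fun z => c z = i ∧
      ∃ A ⊆ s.erase a, IsAntichain (· ≤ ·) (A : Set α) ∧ A.card = k ∧ z ∈ A).exists_maximal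
      ⟨z₀, Finset.mem_filter.2 ⟨hA₀s hz₀, hz₀i, A₀, hA₀s, hA₀a, hA₀k, hz₀⟩⟩
    obtain ⟨hxs, hxi, hxA⟩ := Finset.mem_filter.1 hx.1
    refine ⟨x, fun _ => ⟨hxs, hxi, hxA, fun A hAs hAa hAk z hz hzi => ?_⟩⟩
    rcases hc' z (hAs hz) x hxs (hzi.trans hxi.symm) with hle | hle
    · exact hle
    · exact hx.2 (Finset.mem_filter.2 ⟨hAs hz, hzi, A, hAs, hAa, hAk, hz⟩) hle
  choose x hx using top
  obtain ⟨i, hi, hxa⟩ : ∃ i < k, x i ≤ a := by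
    by_contra! hno
    have hxinj : Set.InjOn x (Finset.range k : Set ℕ) := fun i hi j hj hij => by
      rw [← (hx i (by simpa using hi)).2.1, hij, (hx j (by simpa using hj)).2.1]
    have hanti : IsAntichain (· ≤ ·) ((insert a ((Finset.range k).image x) : Finset α) : Set α) := by
      rw [Finset.coe_insert]
      refine IsAntichain.insert ?_ ?_ ?_
      · intro y hy z hz hyz hle
        obtain ⟨i, hi, rfl⟩ := Finset.mem_image.1 (Finset.mem_coe.1 hy)
        obtain ⟨j, hj, rfl⟩ := Finset.mem_image.1 (Finset.mem_coe.1 hz)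
        rw [Finset.mem_range] at hi hj
        obtain ⟨-, hci, -, hmax⟩ := hx i hi
        obtain ⟨-, hcj, ⟨A, hAs, hAa, hAk, hjA⟩, -⟩ := hx j hj
        obtain ⟨w, hwA, hwi⟩ := hits A hAs hAa hAk i hi
        have hwj := hAa.eq hwA hjA ((hmax A hAs hAa hAk w hwA hwi).trans hle)
        refine hyz (congrArg x ?_)
        rw [← hwi, hwj, hcj]
      · intro y hy _ hle
        obtain ⟨i, hi, rfl⟩ := Finset.mem_image.1 (Finset.mem_coe.1 hy)
        exact hno i (Finset.mem_range.1 hi) hle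
      · intro y hy _ hle
        obtain ⟨i, hi, rfl⟩ := Finset.mem_image.1 (Finset.mem_coe.1 hy)
        have hi := Finset.mem_range.1 hi
        exact hno i hi (ha.2 (Finset.mem_of_mem_erase (hx i hi).1) hle)
    have hcard := h _ (Finset.insert_subset has fun y hy => by
      obtain ⟨i, hi, rfl⟩ := Finset.mem_image.1 hy
      exact Finset.mem_of_mem_erase (hx i (Finset.mem_range.1 hi)).1) hanti
    rw [Finset.card_insert_of_notMem, Finset.card_image_of_injOn hxinj, Finset.card_range] at hcard
    · omega
    · intro hmem
      obtain ⟨i, hi, hia⟩ := Finset.mem_image.1 hmem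
      exact Finset.ne_of_mem_erase (hx i (Finset.mem_range.1 hi)).1 hia
  obtain ⟨-, -, -, hmax⟩ := hx i hi
  refine remove_chain (insert a ((s.erase a).filter fun z => c z = i ∧ z ≤ x i))
    (Finset.insert_subset has ((Finset.filter_subset _ _).trans (Finset.erase_subset _ _)))
    (Finset.mem_insert_self _ _) ?_ ?_
  · intro y hy z hz
    rw [Finset.mem_insert, Finset.mem_filter] at hy hz
    rcases hy with rfl | ⟨hys, hyi, hyx⟩ <;> rcases hz with rfl | ⟨hzs, hzi, hzx⟩
    · exact Or.inl le_rfl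
    · exact Or.inr (hzx.trans hxa)
    · exact Or.inl (hyx.trans hxa)
    · exact hc' y hys z hzs (hyi.trans hzi.symm)
  · intro A hAs hAa hAk
    have hAs' : A ⊆ s.erase a := fun z hz => by
      have hz' := Finset.mem_sdiff.1 (hAs hz)
      exact Finset.mem_erase.2 ⟨fun hza => hz'.2 (hza ▸ Finset.mem_insert_self _ _), hz'.1⟩
    obtain ⟨z, hz, hzi⟩ := hits A hAs' hAa hAk i hi
    exact (Finset.mem_sdiff.1 (hAs hz)).2 (Finset.mem_insert_of_mem
      (Finset.mem_filter.2 ⟨hAs' hz, hzi, hmax A hAs' hAa hAk z hz hzi⟩))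

section Side

variable (cs : CoxeterSystem M W)

open Classical in
/-- The simple reflection `s i` acting on pairs of a group element and a parity: it conjugates
the group element, and flips the parity when that element is `s i` itself. -/
noncomputable def simpleFlip (i : B) : Function.End (W × ZMod 2) := fun p =>
  (cs.simple i * p.1 * cs.simple i, p.2 + if p.1 = cs.simple i then 1 else 0)

open Classical in
lemma simpleFlip_apply (i : B) (p : W × ZMod 2) : simpleFlip cs i p =
    (cs.simple i * p.1 * cs.simple i, p.2 + if p.1 = cs.simple i then 1 else 0) := rfl

open Classical in
lemma simpleFlip_mul_pow (i j : B) (m : ℕ) (t : W) (e : ZMod 2) :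
    ((simpleFlip cs i * simpleFlip cs j) ^ m) (t, e) =
      ((cs.simple i * cs.simple j) ^ m * t * ((cs.simple i * cs.simple j) ^ m)⁻¹,
        e + ∑ k ∈ Finset.range (2 * m),
          if t = cs.simple j * (cs.simple i * cs.simple j) ^ k then 1 else 0) := by
  set r := cs.simple i * cs.simple j with hr
  have hconj : ∀ k : ℕ, (r ^ k)⁻¹ * cs.simple j = cs.simple j * r ^ k := by
    intro k
    induction k with
    | zero => simp
    | succ k ih =>
      rw [pow_succ, mul_inv_rev, mul_assoc, ih, ← mul_assoc, ← pow_succ, pow_succ', hr]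
      simp [mul_assoc]
  have key : ∀ (k : ℕ) (x : W), r ^ k * t * (r ^ k)⁻¹ = cs.simple j * x ↔
      t = cs.simple j * (r ^ k * x * r ^ k) := by
    intro k x
    rw [mul_inv_eq_iff_eq_mul, ← eq_inv_mul_iff_mul_eq, ← mul_assoc, ← mul_assoc, hconj]
    simp only [mul_assoc]
  induction m with
  | zero =>
    rw [pow_zero]
    change (t, e) = _
    simp
  | succ m ih =>
    rw [pow_succ']
    change simpleFlip cs i (simpleFlip cs j (((simpleFlip cs i * simpleFlip cs j) ^ m) (t, e))) = _
    rw [ih, mul_add, Finset.sum_range_succ, Finset.sum_range_succ]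
    have h1 : r ^ m * t * (r ^ m)⁻¹ = cs.simple j ↔ t = cs.simple j * r ^ (2 * m) := by
      simpa [two_mul, pow_add] using key m 1
    have h2 : cs.simple j * (r ^ m * t * (r ^ m)⁻¹) * cs.simple j = cs.simple i ↔
        t = cs.simple j * r ^ (2 * m + 1) := by
      have h3 := key m r
      rw [← pow_succ, ← pow_add, show m + 1 + m = 2 * m + 1 by ring] at h3
      rw [← h3]
      generalize r ^ m * t * (r ^ m)⁻¹ = z
      constructor
      · intro h
        rw [hr, ← h]
        simp [mul_assoc]
      · rintro rfl
        simp [hr, mul_assoc]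
    rw [simpleFlip_apply, simpleFlip_apply]
    ext
    · simp [pow_succ', hr, mul_assoc]
    · simp only [h1, h2, add_assoc]

lemma simpleFlip_isLiftable :
    M.IsLiftable (simpleFlip cs) := by
  classical
  intro i j
  funext ⟨t, e⟩
  change ((simpleFlip cs i * simpleFlip cs j) ^ M i j) (t, e) = (t, e)
  rw [simpleFlip_mul_pow, two_mul, Finset.sum_range_add]
  simp only [pow_add, cs.simple_mul_simple_pow, one_mul, mul_one, inv_one]
  rw [CharTwo.add_self_eq_zero, add_zero]

/-- The action of `W` on pairs of a group element and a parity extending `simpleFlip`. -/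
noncomputable def parityAction : W →* Function.End (W × ZMod 2) :=
  cs.lift ⟨_, simpleFlip_isLiftable cs⟩

lemma parityAction_simple (i : B) (p : W × ZMod 2) : parityAction cs (cs.simple i) p = simpleFlip cs i p :=
  congrFun (cs.lift_apply_simple (simpleFlip_isLiftable cs) i) p

lemma parityAction_mul (u v : W) (p : W × ZMod 2) : parityAction cs (u * v) p = parityAction cs u (parityAction cs v p) := by
  rw [map_mul]; rfl

lemma parityAction_one (p : W × ZMod 2) : parityAction cs 1 p = p := by
  rw [map_one]; rfl

lemma parityAction_apply (w t : W) (e : ZMod 2) :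
    parityAction cs w (t, e) = (w * t * w⁻¹, e + (parityAction cs w (t, 0)).2) := by
  induction w using cs.simple_induction_left generalizing e with
  | one => simp [parityAction_one]
  | mul_simple_left w i ih =>
    rw [parityAction_mul, parityAction_mul, ih e, ih 0, parityAction_simple, parityAction_simple]
    simp [simpleFlip, mul_assoc, add_assoc]

/-- The side of the wall of `t` on which the vertex `w` lies, with `1` lying on side `0`:
the parity of the number of crossings of that wall along a path from `1` to `w`. -/
noncomputable def side (t w : W) : ZMod 2 := (parityAction cs w⁻¹ (t, 0)).2

lemma side_one (t : W) : side cs t 1 = 0 := by simp [side, parityAction_one]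

open Classical in
lemma side_mul_simple (t w : W) (i : B) : side cs t (w * cs.simple i) =
    side cs t w + if t * w = w * cs.simple i then 1 else 0 := by
  have h : w⁻¹ * t * w = cs.simple i ↔ t * w = w * cs.simple i := by
    rw [mul_assoc, inv_mul_eq_iff_eq_mul]
  rw [side, mul_inv_rev, cs.inv_simple, parityAction_mul, parityAction_apply cs w⁻¹ t 0, parityAction_simple]
  simp [simpleFlip, side, h]

lemma side_mul_self {t : W} (ht : cs.IsReflection t) (w : W) :
    side cs t (t * w) = side cs t w + 1 := by
  have hself : parityAction cs t (t, 0) = (t, 1) := by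
    obtain ⟨u, i, rfl⟩ := ht
    rw [parityAction_mul, parityAction_mul, parityAction_apply cs u⁻¹, parityAction_simple]
    set e := (parityAction cs u⁻¹ (u * cs.simple i * u⁻¹, 0)).2 with he
    have hinv : parityAction cs u (cs.simple i, e) = (u * cs.simple i * u⁻¹, 0) := by
      have h := parityAction_mul cs u u⁻¹ (u * cs.simple i * u⁻¹, 0)
      rw [mul_inv_cancel, parityAction_one, parityAction_apply cs u⁻¹, ← he] at h
      simpa [mul_assoc] using h.symm
    rw [parityAction_apply] at hinv
    have h2 : e + (parityAction cs u (cs.simple i, 0)).2 = 0 := congrArg Prod.snd hinv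
    have h3 : u⁻¹ * (u * cs.simple i * u⁻¹) * u⁻¹⁻¹ = cs.simple i := by group
    rw [h3]
    simp only [simpleFlip, if_true, cs.simple_mul_simple_self, one_mul, zero_add]
    rw [parityAction_apply, add_right_comm, h2, zero_add]
  rw [side, mul_inv_rev, parityAction_mul, ht.inv, hself, parityAction_apply, add_comm]
  rfl

lemma mem_leftInvSeq_of_side_ne_zero (t : W) (ω : List B) (h : side cs t (cs.wordProd ω) ≠ 0) :
    t ∈ cs.leftInvSeq ω := by
  classical
  induction ω using List.reverseRecOn with
  | nil => simp [side_one] at h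
  | append_singleton ω i ih =>
    rw [← List.concat_eq_append] at h ⊢
    rw [cs.leftInvSeq_concat, List.concat_eq_append, List.mem_append, List.mem_singleton,
      eq_mul_inv_iff_mul_eq]
    rw [cs.wordProd_concat, side_mul_simple] at h
    by_cases hi : t * cs.wordProd ω = cs.wordProd ω * cs.simple i
    · exact Or.inr hi
    · exact Or.inl (ih (by simpa [hi] using h))

lemma length_mul_lt_of_side_ne_zero {t w : W} (h : side cs t w ≠ 0) :
    cs.length (t * w) < cs.length w := by
  obtain ⟨ω, hω, rfl⟩ := cs.exists_isReduced w
  exact (cs.isLeftInversion_of_mem_leftInvSeq hω (mem_leftInvSeq_of_side_ne_zero cs t ω h)).2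

lemma length_mul_lt_iff_side {t : W} (ht : cs.IsReflection t) (w : W) :
    cs.length (t * w) < cs.length w ↔ side cs t w ≠ 0 := by
  refine ⟨fun hlt h0 => ?_, length_mul_lt_of_side_ne_zero cs⟩
  have h := length_mul_lt_of_side_ne_zero cs (t := t) (w := t * w)
    (by rw [side_mul_self cs ht, h0]; decide)
  rw [← mul_assoc, ht.mul_self, one_mul] at h
  omega

lemma sameSide_iff_side {t : W} (ht : cs.IsReflection t) (u v : W) :
    SameSide cs t u v ↔ side cs t u = side cs t v := by
  rw [SameSide, length_mul_lt_iff_side cs ht, length_mul_lt_iff_side cs ht]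
  generalize side cs t u = a
  generalize side cs t v = b
  revert a b
  decide

end Side

section Walls

variable {cs : CoxeterSystem M W} {t t' r x y : W}

lemma SameSide.symm {u v : W} (h : SameSide cs t u v) : SameSide cs t v u := Iff.symm h

lemma SameSide.trans {u v w : W} (h : SameSide cs t u v) (h' : SameSide cs t v w) :
    SameSide cs t u w := Iff.trans h h'

lemma SeparatesPts.sameSide_or (h : SeparatesPts cs t x y) (v : W) :
    SameSide cs t v x ∨ SameSide cs t v y := by
  unfold SeparatesPts SameSide at *
  tauto

lemma not_sameSide_mul_self (ht : cs.IsReflection t) (u : W) : ¬ SameSide cs t (t * u) u := by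
  rw [sameSide_iff_side cs ht, side_mul_self cs ht]
  generalize side cs t u = a
  revert a
  decide

lemma sameSide_mul_simple_iff (ht : cs.IsReflection t) (u : W) (i : B) :
    SameSide cs t u (u * cs.simple i) ↔ t * u ≠ u * cs.simple i := by
  classical
  rw [sameSide_iff_side cs ht, side_mul_simple]
  split_ifs with h <;> simp [h]

lemma InWallBar.mul_self (ht : cs.IsReflection t) {v : W} (h : InWallBar cs t v) :
    InWallBar cs t (t * v) := by
  obtain ⟨i, hi⟩ := h
  exact ⟨i, by rw [← mul_assoc, ht.mul_self, one_mul, hi, cs.simple_mul_simple_cancel_right]⟩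

lemma exists_inWallBar (ht : cs.IsReflection t) : ∃ v, InWallBar cs t v := by
  obtain ⟨w, i, rfl⟩ := ht
  exact ⟨w, i, by group⟩

/-- A wall separating two vertices on the same side of the wall of `t` meets that side:
a path folded onto that side by `t` still has to cross it. -/
lemma exists_inWallBar_sameSide (ht : cs.IsReflection t) (hr : cs.IsReflection r) {u v : W}
    (huv : SameSide cs t u v) (hruv : ¬ SameSide cs r u v) :
    ∃ a, InWallBar cs r a ∧ SameSide cs t a u := by
  classical
  by_contra! hno
  let fold : W → W := fun w => if SameSide cs t w u then w else t * w
  have hfold : ∀ w, SameSide cs t (fold w) u := by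
    intro w
    by_cases hw : SameSide cs t w u
    · simp [fold, hw]
    · have := not_sameSide_mul_self ht w
      simp only [fold, hw, if_false]
      unfold SameSide at *
      tauto
  have hstep : ∀ w i, SameSide cs r (fold w) (fold (w * cs.simple i)) := by
    intro w i
    by_cases hwi : SameSide cs t w (w * cs.simple i)
    · have hadj : fold (w * cs.simple i) = fold w * cs.simple i := by
        have : SameSide cs t (w * cs.simple i) u ↔ SameSide cs t w u :=
          ⟨hwi.trans, hwi.symm.trans⟩
        simp only [fold, this]
        split_ifs <;> simp [mul_assoc]
      rw [hadj, sameSide_mul_simple_iff hr]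
      exact fun h => hno _ ⟨i, h⟩ (hfold w)
    · have heq : t * w = w * cs.simple i := by
        rwa [sameSide_mul_simple_iff ht, not_not] at hwi
      have hsame : fold w = fold (w * cs.simple i) := by
        have hwi' : SameSide cs t (w * cs.simple i) u ↔ ¬ SameSide cs t w u := by
          unfold SameSide at *
          tauto
        by_cases hw : SameSide cs t w u
        · simp only [fold, if_pos hw, if_neg fun h => hwi'.1 h hw]
          rw [← heq, ← mul_assoc, ht.mul_self, one_mul]
        · simp only [fold, if_neg hw, if_pos (hwi'.2 hw), heq]
      rw [hsame]
      exact Iff.rfl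
  have hall : ∀ g, SameSide cs r (fold u) (fold (u * g)) := by
    intro g
    induction g using cs.simple_induction_right with
    | one => rw [mul_one]; exact Iff.rfl
    | mul_simple_right g i ih => rw [← mul_assoc]; exact ih.trans (hstep _ i)
  have hv := hall (u⁻¹ * v)
  have huu : SameSide cs t u u := Iff.rfl
  rw [mul_inv_cancel_left] at hv
  simp only [fold, huu, huv.symm, if_true] at hv
  exact hruv hv

lemma finite_separating (cs : CoxeterSystem M W) (x y : W) :
    {t | cs.IsReflection t ∧ SeparatesPts cs t x y}.Finite := by
  suffices h : ∀ g, {t | cs.IsReflection t ∧ SeparatesPts cs t x (x * g)}.Finite by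
    simpa using h (x⁻¹ * y)
  intro g
  induction g using cs.simple_induction_right with
  | one => simp [SeparatesPts, SameSide]
  | mul_simple_right g i ih =>
    refine (ih.insert (x * g * cs.simple i * (x * g)⁻¹)).subset ?_
    rintro t ⟨ht, hsep⟩
    by_cases h : SameSide cs t (x * g) (x * g * cs.simple i)
    · refine Or.inr ⟨ht, fun h' => hsep ?_⟩
      rw [← mul_assoc]
      exact h'.trans h
    · rw [sameSide_mul_simple_iff ht, not_not] at h
      exact Or.inl (eq_mul_inv_of_mul_eq h)

/-- The wall of `t` lies between `x` and the wall of `t'`, which lies between the wall of `t`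
and `y`. -/
def WallBefore (cs : CoxeterSystem M W) (x y t t' : W) : Prop :=
  (∀ v, InWallBar cs t' v → SameSide cs t v y) ∧ ∀ v, InWallBar cs t v → SameSide cs t' v x

lemma WallBefore.ne (ht : cs.IsReflection t) (h : WallBefore cs x y t t') : t ≠ t' := by
  rintro rfl
  obtain ⟨v, hv⟩ := exists_inWallBar ht
  exact not_sameSide_mul_self ht v ((h.1 _ (hv.mul_self ht)).trans (h.1 v hv).symm)

lemma WallBefore.parallel (ht : cs.IsReflection t) (h : WallBefore cs x y t t') :
    Parallel cs t t' :=
  ⟨h.ne ht, fun u v hu hv => (h.1 u hu).trans (h.1 v hv).symm,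
    fun u v hu hv => (h.2 u hu).trans (h.2 v hv).symm⟩

lemma Parallel.symm (h : Parallel cs t t') : Parallel cs t' t := ⟨h.1.symm, h.2.2, h.2.1⟩

lemma WallBefore.trans {t'' : W} (ht : cs.IsReflection t) (ht' : cs.IsReflection t')
    (ht'' : cs.IsReflection t'') (hsep : SeparatesPts cs t' x y)
    (h : WallBefore cs x y t t') (h' : WallBefore cs x y t' t'') : WallBefore cs x y t t'' := by
  constructor
  · intro v hv
    by_contra hvy
    obtain ⟨a, ha, hav⟩ := exists_inWallBar_sameSide ht' ht (h'.1 v hv) hvy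
    exact hsep ((h.2 a ha).symm.trans (hav.trans (h'.1 v hv)))
  · intro v hv
    by_contra hvx
    obtain ⟨a, ha, hav⟩ := exists_inWallBar_sameSide ht' ht'' (h.2 v hv) hvx
    exact hsep ((h.2 v hv).symm.trans (hav.symm.trans (h'.1 a ha)))

lemma WallBefore.asymm (ht' : cs.IsReflection t') (hsep : SeparatesPts cs t x y)
    (h : WallBefore cs x y t t') (h' : WallBefore cs x y t' t) : False := by
  obtain ⟨v, hv⟩ := exists_inWallBar ht'
  exact hsep ((h'.2 v hv).symm.trans (h.1 v hv))

/-- If the wall of `t'` lies on the side of `y` of the wall of `t`, then the wall of `t` lies on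
the side of `x` of the wall of `t'`. -/
lemma Parallel.wallBefore (ht : cs.IsReflection t) (ht' : cs.IsReflection t')
    (hsep : SeparatesPts cs t x y) (h : Parallel cs t t')
    (hy : ∀ v, InWallBar cs t' v → SameSide cs t v y) : WallBefore cs x y t t' := by
  refine ⟨hy, fun v hv => ?_⟩
  obtain ⟨a, ha, hax⟩ : ∃ a, InWallBar cs t a ∧ SameSide cs t a x := by
    by_cases hvx : SameSide cs t v x
    · exact ⟨v, hv, hvx⟩
    · refine ⟨t * v, hv.mul_self ht, ?_⟩
      have := not_sameSide_mul_self ht v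
      unfold SameSide at *
      tauto
  refine (h.2.2 v a hv ha).trans ?_
  by_contra hax'
  obtain ⟨b, hb, hba⟩ := exists_inWallBar_sameSide ht ht' hax hax'
  exact hsep ((hba.trans hax).symm.trans (hy b hb))

lemma SeparatesPts.symm (h : SeparatesPts cs t x y) : SeparatesPts cs t y x :=
  fun h' => h (SameSide.symm h')

lemma Parallel.wallBefore_or (ht : cs.IsReflection t) (ht' : cs.IsReflection t')
    (hsep : SeparatesPts cs t x y) (h : Parallel cs t t') :
    WallBefore cs x y t t' ∨ WallBefore cs x y t' t := by
  obtain ⟨a, ha⟩ := exists_inWallBar ht'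
  rcases hsep.sameSide_or a with hax | hay
  · exact Or.inr (h.wallBefore ht ht' hsep.symm fun v hv => (h.2.1 v a hv ha).trans hax).symm
  · exact Or.inl (h.wallBefore ht ht' hsep fun v hv => (h.2.1 v a hv ha).trans hay)

/-- The walls separating `x` from `y`, ordered by how they are passed on the way from `x`
to `y`. -/
@[reducible] def separatingWallOrder (cs : CoxeterSystem M W) (x y : W) :
    PartialOrder {t // cs.IsReflection t ∧ SeparatesPts cs t x y} where
  le t t' := t = t' ∨ WallBefore cs x y t t'
  le_refl t := Or.inl rfl
  le_trans := by
    rintro a b c (rfl | hab) (rfl | hbc)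
    · exact Or.inl rfl
    · exact Or.inr hbc
    · exact Or.inr hab
    · exact Or.inr (hab.trans a.2.1 b.2.1 c.2.1 b.2.2 hbc)
  le_antisymm := by
    rintro a b (rfl | hab) (hba | hba)
    · rfl
    · rfl
    · exact hba.symm
    · exact (hab.asymm b.2.1 a.2.2 hba).elim

end Walls

/-- If `F` bounds the number of pairwise crossing walls of `Λ(W,S)`, then for any vertices
`x` and `y` the walls separating `x` and `y` can be partitioned into at most `F` subsets,
each consisting of pairwise parallel walls. (The partition is given by a colouring `col`
with fewer than `F` colours such that distinct walls of the same colour are parallel.) -/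
theorem partition_into_parallel {B : Type*} {W : Type*} [Group W] [Finite B]
    {M : CoxeterMatrix B} (cs : CoxeterSystem M W)
    (F : ℕ)
    (hF : ∀ T : Finset W, (∀ t ∈ T, cs.IsReflection t) →
      (∀ t ∈ T, ∀ t' ∈ T, t ≠ t' → Crosses cs t t') → T.card ≤ F) :
    ∀ x y : W, ∃ col : W → ℕ,
      (∀ t : W, cs.IsReflection t → SeparatesPts cs t x y → col t < F) ∧
      (∀ t t' : W, cs.IsReflection t → cs.IsReflection t' →
        SeparatesPts cs t x y → SeparatesPts cs t' x y →
        t ≠ t' → col t = col t' → Parallel cs t t') := by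
  classical
  intro x y
  have hfin : Finite {t // cs.IsReflection t ∧ SeparatesPts cs t x y} := finite_separating cs x y
  have := Fintype.ofFinite {t // cs.IsReflection t ∧ SeparatesPts cs t x y}
  let _ := separatingWallOrder cs x y
  obtain ⟨c, hc, hc'⟩ := exists_chain_coloring_of_antichain_card_le F
    (Finset.univ : Finset {t // cs.IsReflection t ∧ SeparatesPts cs t x y}) (by
      intro A _ hA
      rw [← Finset.card_map (Function.Embedding.subtype _)]
      refine hF _ (fun t ht => ?_) (fun t ht t' ht' hne => ⟨hne, fun hpar => ?_⟩)
      · obtain ⟨a, -, rfl⟩ := Finset.mem_map.1 ht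
        exact a.2.1
      · obtain ⟨a, ha, rfl⟩ := Finset.mem_map.1 ht
        obtain ⟨b, hb, rfl⟩ := Finset.mem_map.1 ht'
        have hab : a ≠ b := fun h => hne (congrArg _ h)
        rcases hpar.wallBefore_or a.2.1 b.2.1 a.2.2 with h | h
        · exact hA ha hb hab (Or.inr h)
        · exact hA hb ha hab.symm (Or.inr h))
  refine ⟨fun t => if h : cs.IsReflection t ∧ SeparatesPts cs t x y then c ⟨t, h⟩ else 0,
    fun t ht hsep => ?_, fun t t' ht ht' hsep hsep' hne hcol => ?_⟩
  · simpa [ht, hsep] using hc ⟨t, ht, hsep⟩ (Finset.mem_univ _)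
  · simp only [ht, hsep, ht', hsep', and_self, dif_pos] at hcol
    rcases hc' _ (Finset.mem_univ _) _ (Finset.mem_univ _) hcol with (h | h) | (h | h)
    · exact absurd (congrArg Subtype.val h) hne
    · exact h.parallel ht
    · exact absurd (congrArg Subtype.val h).symm hne
    · exact (h.parallel ht').symm

end CoxTrack
end
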